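/- arXiv:2502.08632 — 8 statements merged into one kernel-verified Lean document; each statement's English description precedes it below -/
import Mathlib

section
/- Let S and A be finite nonempty sets, let P : S × A × S → [0,1] (written P(s′|s,a)), and let β : S → [0,1]. Define F(s′) := Σ_{u∈S} β(u)·(1/|A|)·Σ_{a∈A} P(s′|u,a), and for s, s′ ∈ S and a ∈ A define the kinematics f(s,s′;a) := P(s′|s,a)/(P(s′|s,a)+F(s′)), interpreted as 0 when the denominator is 0. Then for every s, s′ ∈ S and a ∈ A: 1 − f(s,s′;a) ≥ β(s)/(2|A|). -/
/-- Let `S` and `A` be finite nonempty sets, `P : S × A × S → [0,1]`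
(written `P s a s'` for `P(s′|s,a)`), and `β : S → [0,1]`.  With
`F s' = Σ_{u} β u · (1/|A|) · Σ_a P u a s'` and the kinematics
`f s s' a = P s a s' / (P s a s' + F s')` (interpreted as `0` when the denominator
vanishes), one has `1 − f s s' a ≥ β s / (2|A|)` for all `s, s', a`. -/
theorem stmt1 {S A : Type*} [Fintype S] [Fintype A] [Nonempty S] [Nonempty A]
    (P : S → A → S → ℝ) (hP : ∀ s a s', 0 ≤ P s a s' ∧ P s a s' ≤ 1)
    (β : S → ℝ) (hβ : ∀ s, 0 ≤ β s ∧ β s ≤ 1)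
    (F : S → ℝ)
    (hF : ∀ s', F s' = ∑ u, β u * ((Fintype.card A : ℝ)⁻¹ * ∑ a, P u a s'))
    (f : S → S → A → ℝ)
    (hf : ∀ s s' a,
      f s s' a = if P s a s' + F s' = 0 then 0 else P s a s' / (P s a s' + F s'))
    (s s' : S) (a : A) :
    β s / (2 * Fintype.card A) ≤ 1 - f s s' a := by
  have hn : (1 : ℝ) ≤ Fintype.card A := by exact_mod_cast Fintype.card_pos (α := A)
  have hn0 : (0 : ℝ) < Fintype.card A := by linarith
  set c : ℝ := β s * (Fintype.card A : ℝ)⁻¹ with hc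
  have hc0 : 0 ≤ c := mul_nonneg (hβ s).1 (by positivity)
  have hc1 : c ≤ 1 := mul_le_one₀ (hβ s).2 (by positivity) (inv_le_one_of_one_le₀ hn)
  have hcβ : β s / (2 * Fintype.card A) = c / 2 := by
    rw [hc]
    field_simp
  have hp : 0 ≤ P s a s' := (hP s a s').1
  have hsum : ∀ u, 0 ≤ ∑ b, P u b s' := fun u => Finset.sum_nonneg fun b _ => (hP u b s').1
  have hpF : c * P s a s' ≤ F s' := by
    calc c * P s a s' ≤ c * ∑ b, P s b s' :=
          mul_le_mul_of_nonneg_left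
            (Finset.single_le_sum (f := fun b => P s b s') (fun b _ => (hP s b s').1)
              (Finset.mem_univ a)) hc0
      _ = β s * ((Fintype.card A : ℝ)⁻¹ * ∑ b, P s b s') := by rw [hc, mul_assoc]
      _ ≤ F s' := by
          rw [hF]
          exact Finset.single_le_sum
            (f := fun u => β u * ((Fintype.card A : ℝ)⁻¹ * ∑ b, P u b s'))
            (fun u _ => mul_nonneg (hβ u).1 (mul_nonneg (by positivity) (hsum u)))
            (Finset.mem_univ s)
  have hF0 : 0 ≤ F s' := (mul_nonneg hc0 hp).trans hpF
  rw [hcβ, hf]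
  split_ifs with h
  · linarith
  · have hD : 0 < P s a s' + F s' := lt_of_le_of_ne (add_nonneg hp hF0) (Ne.symm h)
    rw [one_sub_div h, le_div_iff₀ hD]
    linarith [mul_le_mul_of_nonneg_right hc1 hF0]
end

section
/- Let X and S be finite sets, φ : X → S, and let D be a probability distribution on X × X that is φ-realizable, meaning there exist functions p : S × S → [0,∞) and q₁, q₂ : X → [0,∞) such that D(x₁,x₂) = p(φ(x₁),φ(x₂))·q₁(x₁)·q₂(x₂) for all (x₁,x₂). Let (x₁,x₂) and (x₁′,x₂′) be two independent draws from D. Then for every s ∈ S and every function g : X × X → ℝ: E[ 1[φ(x₂)=s]·1[φ(x₂′)=s]·g(x₁,x₂) ] = E[ 1[φ(x₂)=s]·1[φ(x₂′)=s]·g(x₁′,x₂) ]. -/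
open scoped Classical

/-- Let `X, S` be finite, `φ : X → S`, and let `D` be a probability
distribution on `X × X` that is `φ`-realizable, i.e. `D (x₁,x₂) = p (φ x₁) (φ x₂) *
q₁ x₁ * q₂ x₂` for nonnegative `p, q₁, q₂`.  For two independent draws
`(x₁,x₂), (x₁′,x₂′) ~ D`, every `s ∈ S`, and every `g : X × X → ℝ`:
`E[1[φ x₂ = s]·1[φ x₂′ = s]·g x₁ x₂] = E[1[φ x₂ = s]·1[φ x₂′ = s]·g x₁′ x₂]`. -/
theorem stmt2 {X S : Type*} [Fintype X] [Fintype S]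
    (φ : X → S) (D : X × X → ℝ)
    (hD0 : ∀ z, 0 ≤ D z) (hD1 : ∑ z, D z = 1)
    (p : S → S → ℝ) (q₁ q₂ : X → ℝ)
    (hp : ∀ s t, 0 ≤ p s t) (hq₁ : ∀ x, 0 ≤ q₁ x) (hq₂ : ∀ x, 0 ≤ q₂ x)
    (hfac : ∀ x₁ x₂, D (x₁, x₂) = p (φ x₁) (φ x₂) * q₁ x₁ * q₂ x₂)
    (s : S) (g : X → X → ℝ) :
    (∑ x₁, ∑ x₂, ∑ x₁', ∑ x₂', D (x₁, x₂) * D (x₁', x₂') *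
        ((if φ x₂ = s then (1 : ℝ) else 0) * (if φ x₂' = s then (1 : ℝ) else 0) *
          g x₁ x₂)) =
    ∑ x₁, ∑ x₂, ∑ x₁', ∑ x₂', D (x₁, x₂) * D (x₁', x₂') *
        ((if φ x₂ = s then (1 : ℝ) else 0) * (if φ x₂' = s then (1 : ℝ) else 0) *
          g x₁' x₂) := by
  rw [Finset.sum_comm]
  conv_rhs => rw [Finset.sum_comm]
  refine Finset.sum_congr rfl fun x₂ _ => ?_
  conv_rhs => rw [Finset.sum_comm]
  refine Finset.sum_congr rfl fun x₁ _ => Finset.sum_congr rfl fun x₁' _ =>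
    Finset.sum_congr rfl fun x₂' _ => ?_
  by_cases h : φ x₂ = s
  · by_cases h' : φ x₂' = s
    · simp only [hfac, h, h']
      ring
    · simp [h']
  · simp [h]
end

section
/- Let S, X, A be finite sets with A nonempty, φ : X → S, β a probability distribution on S, P(·|s,a) a probability distribution on S for each (s,a) ∈ S × A, and O(·|s), O′(·|s) probability distributions on X supported on {x : φ(x) = s} for each s ∈ S. Fix a ∈ A and define F(s′) := Σ_{s∈S} β(s)·(1/|A|)·Σ_{ã∈A} P(s′|s,ã), and define μ₁(x,x′) := β(φ(x))·O(x|φ(x))·P(φ(x′)|φ(x),a)·O′(x′|φ(x′)) and μ₀(x,x′) := β(φ(x))·O(x|φ(x))·F(φ(x′))·O′(x′|φ(x′)). Then: (i) μ₀ and μ₁ are probability distributions on X × X; (ii) both are φ-realizable, i.e. each factors as p(φ(x),φ(x′))·q₁(x)·q₂(x′) for suitable nonnegative functions; and (iii) for every (x,x′) with μ₀(x,x′)+μ₁(x,x′) > 0, μ₁(x,x′)/(μ₀(x,x′)+μ₁(x,x′)) = P(φ(x′)|φ(x),a) / (P(φ(x′)|φ(x),a) + F(φ(x′))). In particular, if y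 ~ Bernoulli(1/2) and (x,x′) is then drawn from μ_y, the conditional probability that y = 1 given (x,x′) equals the kinematics function f(φ(x),φ(x′);a) := P(φ(x′)|φ(x),a)/(P(φ(x′)|φ(x),a)+F(φ(x′))). -/
open scoped Classical

/-- Summing against an emission kernel supported on the fibres of `φ` reduces a sum over
observations to a sum over latent states. -/
theorem sum_mul_emission {S X : Type*} [Fintype S] [Fintype X] (φ : X → S) (O : S → X → ℝ)
    (hO1 : ∀ s, ∑ x, O s x = 1) (hOsupp : ∀ s x, φ x ≠ s → O s x = 0) (g : S → ℝ) :
    ∑ x, g (φ x) * O (φ x) x = ∑ s, g s := by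
  have h : ∀ x, g (φ x) * O (φ x) x = ∑ s, g s * O s x := fun x => by
    rw [Finset.sum_eq_single (φ x)]
    · intro s _ hs
      rw [hOsupp s x hs.symm, mul_zero]
    · simp
  simp_rw [h]
  rw [Finset.sum_comm]
  simp_rw [← Finset.mul_sum, hO1, mul_one]

/-- The law of a pair of emissions, from a latent distribution `β` and a latent transition
kernel `Q`, has total mass one. -/
theorem sum_pair_emission {S X : Type*} [Fintype S] [Fintype X] (φ : X → S) (β : S → ℝ)
    (hβ1 : ∑ s, β s = 1) (Q : S → S → ℝ) (hQ1 : ∀ s, ∑ s', Q s s' = 1) (O O' : S → X → ℝ)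
    (hO1 : ∀ s, ∑ x, O s x = 1) (hOsupp : ∀ s x, φ x ≠ s → O s x = 0)
    (hO'1 : ∀ s, ∑ x, O' s x = 1) (hO'supp : ∀ s x, φ x ≠ s → O' s x = 0) :
    ∑ x, ∑ x', β (φ x) * O (φ x) x * Q (φ x) (φ x') * O' (φ x') x' = 1 := by
  have h : ∀ x, ∑ x', β (φ x) * O (φ x) x * Q (φ x) (φ x') * O' (φ x') x' =
      β (φ x) * O (φ x) x := fun x => by
    rw [sum_mul_emission φ O' hO'1 hO'supp fun s' => β (φ x) * O (φ x) x * Q (φ x) s',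
      ← Finset.mul_sum, hQ1, mul_one]
  simp_rw [h]
  rw [sum_mul_emission φ O hO1 hOsupp β, hβ1]

/-- The next-state marginal under the uniform action distribution has total mass one. -/
theorem sum_marginal_uniform {S A : Type*} [Fintype S] [Fintype A] [Nonempty A] (β : S → ℝ)
    (hβ1 : ∑ s, β s = 1) (P : S → A → S → ℝ) (hP1 : ∀ s a, ∑ s', P s a s' = 1) :
    ∑ s', ∑ s, β s * ((Fintype.card A : ℝ)⁻¹ * ∑ b, P s b s') = 1 := by
  have hcard : (Fintype.card A : ℝ) ≠ 0 := Nat.cast_ne_zero.mpr Fintype.card_ne_zero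
  rw [Finset.sum_comm]
  have h : ∀ s, ∑ s', β s * ((Fintype.card A : ℝ)⁻¹ * ∑ b, P s b s') = β s := fun s => by
    rw [← Finset.mul_sum, ← Finset.mul_sum, Finset.sum_comm]
    simp [hP1, hcard]
  simp_rw [h, hβ1]

/-- Let `S, X, A` be finite with `A` nonempty, `φ : X → S`,
`β` a distribution on `S`, `P(·|s,a)` distributions on `S`, and `O(·|s), O′(·|s)`
distributions on `X` supported on `{x : φ x = s}`.  Fix `a ∈ A`, set
`F s' = Σ_s β s · (1/|A|) Σ_b P s b s'`, and define
`μ₁ (x,x') = β (φ x) · O (φ x) x · P (φ x) a (φ x') · O' (φ x') x'` and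
`μ₀ (x,x') = β (φ x) · O (φ x) x · F (φ x') · O' (φ x') x'`.  Then (i) `μ₀, μ₁`
are probability distributions on `X × X`; (ii) both are `φ`-realizable; and
(iii) whenever `μ₀ (x,x') + μ₁ (x,x') > 0`,
`μ₁/(μ₀+μ₁) = P (φ x) a (φ x') / (P (φ x) a (φ x') + F (φ x'))`. -/
theorem stmt4 {S X A : Type*} [Fintype S] [Fintype X] [Fintype A] [Nonempty A]
    (φ : X → S) (β : S → ℝ) (hβ0 : ∀ s, 0 ≤ β s) (hβ1 : ∑ s, β s = 1)
    (P : S → A → S → ℝ) (hP0 : ∀ s a s', 0 ≤ P s a s')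
    (hP1 : ∀ s a, ∑ s', P s a s' = 1)
    (O O' : S → X → ℝ)
    (hO0 : ∀ s x, 0 ≤ O s x) (hO1 : ∀ s, ∑ x, O s x = 1)
    (hOsupp : ∀ s x, φ x ≠ s → O s x = 0)
    (hO'0 : ∀ s x, 0 ≤ O' s x) (hO'1 : ∀ s, ∑ x, O' s x = 1)
    (hO'supp : ∀ s x, φ x ≠ s → O' s x = 0)
    (a : A) (F : S → ℝ)
    (hF : ∀ s', F s' = ∑ s, β s * ((Fintype.card A : ℝ)⁻¹ * ∑ b, P s b s'))
    (μ₀ μ₁ : X × X → ℝ)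
    (hμ₁ : ∀ x x', μ₁ (x, x') = β (φ x) * O (φ x) x * P (φ x) a (φ x') * O' (φ x') x')
    (hμ₀ : ∀ x x', μ₀ (x, x') = β (φ x) * O (φ x) x * F (φ x') * O' (φ x') x') :
    ((∀ z, 0 ≤ μ₀ z) ∧ ∑ z, μ₀ z = 1) ∧
    ((∀ z, 0 ≤ μ₁ z) ∧ ∑ z, μ₁ z = 1) ∧
    (∃ (p : S → S → ℝ) (q₁ q₂ : X → ℝ), (∀ s₁ s₂, 0 ≤ p s₁ s₂) ∧ (∀ x, 0 ≤ q₁ x) ∧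
      (∀ x, 0 ≤ q₂ x) ∧ ∀ x x', μ₀ (x, x') = p (φ x) (φ x') * q₁ x * q₂ x') ∧
    (∃ (p : S → S → ℝ) (q₁ q₂ : X → ℝ), (∀ s₁ s₂, 0 ≤ p s₁ s₂) ∧ (∀ x, 0 ≤ q₁ x) ∧
      (∀ x, 0 ≤ q₂ x) ∧ ∀ x x', μ₁ (x, x') = p (φ x) (φ x') * q₁ x * q₂ x') ∧
    (∀ x x', 0 < μ₀ (x, x') + μ₁ (x, x') →
      μ₁ (x, x') / (μ₀ (x, x') + μ₁ (x, x')) =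
        P (φ x) a (φ x') / (P (φ x) a (φ x') + F (φ x'))) := by
  have hF0 : ∀ s', 0 ≤ F s' := fun s' => by
    rw [hF]
    exact Finset.sum_nonneg fun s _ => mul_nonneg (hβ0 s)
      (mul_nonneg (by positivity) (Finset.sum_nonneg fun b _ => hP0 s b s'))
  have hF1 : ∑ s', F s' = 1 := by
    simp_rw [hF]
    exact sum_marginal_uniform β hβ1 P hP1
  refine ⟨⟨?_, ?_⟩, ⟨?_, ?_⟩, ?_, ?_, ?_⟩
  · rintro ⟨x, x'⟩
    rw [hμ₀]
    exact mul_nonneg (mul_nonneg (mul_nonneg (hβ0 _) (hO0 _ _)) (hF0 _)) (hO'0 _ _)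
  · rw [Fintype.sum_prod_type]
    simp_rw [hμ₀]
    exact sum_pair_emission φ β hβ1 (fun _ => F) (fun _ => hF1) O O' hO1 hOsupp hO'1 hO'supp
  · rintro ⟨x, x'⟩
    rw [hμ₁]
    exact mul_nonneg (mul_nonneg (mul_nonneg (hβ0 _) (hO0 _ _)) (hP0 _ _ _)) (hO'0 _ _)
  · rw [Fintype.sum_prod_type]
    simp_rw [hμ₁]
    exact sum_pair_emission φ β hβ1 (fun s => P s a) (fun s => hP1 s a) O O' hO1 hOsupp
      hO'1 hO'supp
  · refine ⟨fun s s' => β s * F s', fun x => O (φ x) x, fun x => O' (φ x) x,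
      fun s s' => mul_nonneg (hβ0 s) (hF0 s'), fun x => hO0 _ x, fun x => hO'0 _ x,
      fun x x' => ?_⟩
    rw [hμ₀]
    ring
  · refine ⟨fun s s' => β s * P s a s', fun x => O (φ x) x, fun x => O' (φ x) x,
      fun s s' => mul_nonneg (hβ0 s) (hP0 s a s'), fun x => hO0 _ x, fun x => hO'0 _ x,
      fun x x' => ?_⟩
    rw [hμ₁]
    ring
  · intro x x' hpos
    have h₁ : μ₁ (x, x') = β (φ x) * O (φ x) x * O' (φ x') x' * P (φ x) a (φ x') := by
      rw [hμ₁]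
      ring
    have hsum : μ₀ (x, x') + μ₁ (x, x') =
        β (φ x) * O (φ x) x * O' (φ x') x' * (P (φ x) a (φ x') + F (φ x')) := by
      rw [hμ₀, hμ₁]
      ring
    rw [hsum] at hpos ⊢
    rw [h₁, mul_div_mul_left _ _ (left_ne_zero_of_mul hpos.ne')]
end

section
/- Let S, X, A be finite sets with A nonempty, φ : X → S, P(·|s,a) a probability distribution on S for each (s,a) ∈ S × A, and O(·|s) a probability distribution on X supported on {x : φ(x)=s} for each s ∈ S. Fix m ≥ 1, latent states t₁,…,t_m ∈ S, an index i ∈ {1,…,m}, and an action a ∈ A. Consider the random process: draw j uniformly from {1,…,m} and ã uniformly from A, then s′ ~ P(·|t_j,ã), then x′ ~ O(·|s′), and set y := 1[j = i and ã = a]. Then for every x ∈ X with Pr[x′ = x] > 0: Pr[y = 1 | x′ = x] = P(φ(x)|t_i,a) / ( Σ_{j=1}^m Σ_{a′∈A} P(φ(x)|t_j,a′) ). In particular the conditional mean of y given x′ depends on x′ only through φ(x′). -/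
open scoped Classical

/-- If `O · x` vanishes away from `s₀`, then averaging `O · x` against `p` picks out `s₀`. -/
theorem sum_mul_emission_eq {S X : Type*} [Fintype S] (φ : X → S) (O : S → X → ℝ)
    (hO : ∀ s x, φ x ≠ s → O s x = 0) (p : S → ℝ) (x : X) :
    ∑ s, p s * O s x = p (φ x) * O (φ x) x :=
  Fintype.sum_eq_single (φ x) fun s hs => by rw [hO s x hs.symm, mul_zero]

/-- Let `S, X, A` be finite with `A` nonempty, `φ : X → S`,
`P(·|s,a)` distributions on `S`, and `O(·|s)` distributions on `X` supported on
`{x : φ x = s}`.  Fix `m ≥ 1`, latent states `t 1, …, t m`, an index `i`, and an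
action `a`.  In the process: `j ~ Unif [m]`, `a' ~ Unif A`, `s' ~ P(·|t j, a')`,
`x' ~ O(·|s')`, `y := 1[j = i ∧ a' = a]`, the marginal `prX x = Pr[x' = x]` and the
joint `prY1X x = Pr[y = 1 ∧ x' = x]` are as written below; then for every `x` with
`prX x > 0`:
`prY1X x / prX x = P (t i) a (φ x) / Σ_{j,a'} P (t j) a' (φ x)`. -/
theorem stmt5 {S X A : Type*} [Fintype S] [Fintype X] [Fintype A] [Nonempty A]
    (φ : X → S)
    (P : S → A → S → ℝ) (hP0 : ∀ s a s', 0 ≤ P s a s')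
    (hP1 : ∀ s a, ∑ s', P s a s' = 1)
    (O : S → X → ℝ) (hO0 : ∀ s x, 0 ≤ O s x) (hO1 : ∀ s, ∑ x, O s x = 1)
    (hOsupp : ∀ s x, φ x ≠ s → O s x = 0)
    (m : ℕ) (hm : 1 ≤ m) (t : Fin m → S) (i : Fin m) (a : A)
    (prX prY1X : X → ℝ)
    (hprX : ∀ x, prX x = ((m : ℝ) * Fintype.card A)⁻¹ *
        ∑ j, ∑ a' : A, ∑ s', P (t j) a' s' * O s' x)
    (hprY1X : ∀ x, prY1X x = ((m : ℝ) * Fintype.card A)⁻¹ *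
        ∑ s', P (t i) a s' * O s' x)
    (x : X) (hx : 0 < prX x) :
    prY1X x / prX x = P (t i) a (φ x) / ∑ j, ∑ a', P (t j) a' (φ x) := by
  have key := fun s b => sum_mul_emission_eq φ O hOsupp (P s b) x
  rw [hprX x] at hx
  rw [hprY1X x, hprX x]
  simp only [key, ← Finset.sum_mul] at hx ⊢
  have hc : ((m : ℝ) * Fintype.card A)⁻¹ ≠ 0 := left_ne_zero_of_mul hx.ne'
  have hO : O (φ x) x ≠ 0 := right_ne_zero_of_mul (right_ne_zero_of_mul hx.ne')
  rw [mul_div_mul_left _ _ hc, mul_div_mul_right _ _ hO]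
end

section
/- Let M be a finite-horizon latent MDP with state space S, fix parameters σ ≥ σ′ > 0 and a finite set Γ ⊂ Π of policies, and let M̄₁(Γ),…,M̄_H(Γ) be the truncated MDPs defined in the context; write M̄₀(Γ) := M. Then for every h ∈ {1,…,H}, every s ∈ S, and every policy π: d^{M̄_h(Γ),π}_h(s) ≤ d^{M̄_{h−1}(Γ),π}_h(s). Consequently, for every function f : S ∪ {⊥} → [0,∞) with f(⊥) = 0: E^{M̄_h(Γ),π}[f(s_h)] ≤ E^{M̄_{h−1}(Γ),π}[f(s_h)]. -/
open scoped Classical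

section MDPDefs

/- Throughout, internal step index `k : ℕ` corresponds to step `k + 1` of the informal
statement (so an informal step `h ∈ {1,…,H}` is the internal index `h - 1`).
`P1` is the initial latent-state distribution and `P k s a s'` is the transition
probability from state `s` at internal step `k` to state `s'` at internal step `k+1`
(i.e. the transition kernel `P_{k+2}` of the informal statement). -/

variable {S A : Type*}

/-- `π` is a valid (time-inhomogeneous, possibly randomized) policy:
at every internal step `k` and state `s`, `π k s` is a distribution on actions. -/
def IsPolicy [Fintype A] (π : ℕ → S → A → ℝ) : Prop :=
  ∀ k s, (∀ a, 0 ≤ π k s a) ∧ ∑ a, π k s a = 1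

/-- Visitation probabilities in the (untruncated) latent MDP `M = (P1, P)`:
`visit P1 P π k s` is `d^{M,π}_{k+1}(s)` of the informal statement. -/
noncomputable def visit [Fintype S] [Fintype A] (P1 : S → ℝ)
    (P : ℕ → S → A → S → ℝ) (π : ℕ → S → A → ℝ) : ℕ → S → ℝ
  | 0, s => P1 s
  | k + 1, s' => ∑ s, ∑ a, visit P1 P π k s * π k s a * P k s a s'

/-- Visitation probabilities in the `T`-truncated MDP: the state space is `Option S`,
with `none` playing the role of the absorbing terminal state `⊥`, and `T k` is the
truncation set used for the transition into internal step `k` (i.e. the set `T_{k+1}`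
of the informal statement). -/
noncomputable def truncVisit [Fintype S] [Fintype A] (P1 : S → ℝ)
    (P : ℕ → S → A → S → ℝ) (T : ℕ → Set S) (π : ℕ → S → A → ℝ) :
    ℕ → Option S → ℝ
  | 0, some s => if s ∈ T 0 then P1 s else 0
  | 0, none => ∑ s ∈ Finset.univ.filter (fun s => s ∉ T 0), P1 s
  | k + 1, some s' =>
      if s' ∈ T (k + 1) then
        ∑ s, ∑ a, truncVisit P1 P T π k (some s) * π k s a * P k s a s'
      else 0
  | k + 1, none =>
      truncVisit P1 P T π k none +
        ∑ s, ∑ a, truncVisit P1 P T π k (some s) * π k s a *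
          ∑ s' ∈ Finset.univ.filter (fun s' => s' ∉ T (k + 1)), P k s a s'

/-- Supremum over all valid policies. -/
noncomputable def polSup [Fintype A] (f : (ℕ → S → A → ℝ) → ℝ) : ℝ :=
  sSup (f '' {π | IsPolicy π})

/-- `prefixSets P1 P σ k` is the family of truncation sets of the truncated MDP
`M̄_{k+1}(∅)` of the informal statement: it equals `S_{j+1}(∅)` for `j ≤ k` and the
whole state space for `j > k`. -/
noncomputable def prefixSets [Fintype S] [Fintype A] (P1 : S → ℝ)
    (P : ℕ → S → A → S → ℝ) (σ : ℝ) : ℕ → ℕ → Set S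
  | 0 => fun j => if j = 0 then {s | σ ≤ P1 s} else Set.univ
  | k + 1 => fun j =>
      if j ≤ k then prefixSets P1 P σ k j
      else if j = k + 1 then
        {s | σ ≤ polSup fun π =>
          truncVisit P1 P (prefixSets P1 P σ k) π (k + 1) (some s)}
      else Set.univ

/-- `SRchEmpty P1 P σ k` is the set `S_{k+1}(∅)` of the informal statement; the family
`SRchEmpty P1 P σ` is the family of truncation sets of `M̄(∅)`. -/
noncomputable def SRchEmpty [Fintype S] [Fintype A] (P1 : S → ℝ)
    (P : ℕ → S → A → S → ℝ) (σ : ℝ) (k : ℕ) : Set S :=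
  prefixSets P1 P σ k k

/-- `SRchGam P1 P σ σ' Γ k` is the set `S_{k+1}(Γ)` of the informal statement (for
`Γ = ∅` it coincides with `SRchEmpty`, since then the second set below is empty);
the family `SRchGam P1 P σ σ' Γ` is the family of truncation sets of `M̄(Γ)`. -/
noncomputable def SRchGam [Fintype S] [Fintype A] (P1 : S → ℝ)
    (P : ℕ → S → A → S → ℝ) (σ σ' : ℝ) (Γ : Finset (ℕ → S → A → ℝ)) (k : ℕ) :
    Set S :=
  SRchEmpty P1 P σ k ∪
    {s | σ' ≤ (Γ.card : ℝ)⁻¹ * ∑ π ∈ Γ, visit P1 P π k s}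

end MDPDefs

/-- `MbarSets P1 P σ σ' Γ h` is the family of truncation sets of the truncated MDP
`M̄_h(Γ)` of the informal statement (with `MbarSets … 0` corresponding to
`M̄₀(Γ) := M`, i.e. no truncation at all). -/
noncomputable def MbarSets {S A : Type*} [Fintype S] [Fintype A] (P1 : S → ℝ)
    (P : ℕ → S → A → S → ℝ) (σ σ' : ℝ) (Γ : Finset (ℕ → S → A → ℝ)) :
    ℕ → ℕ → Set S
  | 0 => fun _ => Set.univ
  | h + 1 => fun j => if j ≤ h then SRchGam P1 P σ σ' Γ j else Set.univ

lemma truncVisit_some_nonneg {S A : Type*} [Fintype S] [Fintype A] {P1 : S → ℝ}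
    {P : ℕ → S → A → S → ℝ} {π : ℕ → S → A → ℝ} (hP1 : ∀ s, 0 ≤ P1 s)
    (hP : ∀ k s a s', 0 ≤ P k s a s') (hπ : ∀ k s a, 0 ≤ π k s a) (T : ℕ → Set S)
    (k : ℕ) (s : S) : 0 ≤ truncVisit P1 P T π k (some s) := by
  induction k generalizing s with
  | zero =>
    rw [truncVisit]
    split_ifs
    exacts [hP1 s, le_rfl]
  | succ k ih =>
    rw [truncVisit]
    split_ifs
    · exact Finset.sum_nonneg fun t _ => Finset.sum_nonneg fun a _ =>
        mul_nonneg (mul_nonneg (ih t) (hπ k t a)) (hP k t a s)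
    · exact le_rfl

/-- Visitation probabilities of genuine states are monotone in the truncation sets. -/
lemma truncVisit_some_mono {S A : Type*} [Fintype S] [Fintype A] {P1 : S → ℝ}
    {P : ℕ → S → A → S → ℝ} {π : ℕ → S → A → ℝ} (hP1 : ∀ s, 0 ≤ P1 s)
    (hP : ∀ k s a s', 0 ≤ P k s a s') (hπ : ∀ k s a, 0 ≤ π k s a) {T T' : ℕ → Set S}
    (hT : ∀ k, T k ⊆ T' k) (k : ℕ) (s : S) :
    truncVisit P1 P T π k (some s) ≤ truncVisit P1 P T' π k (some s) := by
  induction k generalizing s with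
  | zero =>
    by_cases hs : s ∈ T 0
    · simp [truncVisit, hs, hT 0 hs]
    · rw [truncVisit, if_neg hs]
      exact truncVisit_some_nonneg hP1 hP hπ T' 0 s
  | succ k ih =>
    by_cases hs : s ∈ T (k + 1)
    · rw [truncVisit, if_pos hs, truncVisit, if_pos (hT _ hs)]
      exact Finset.sum_le_sum fun t _ => Finset.sum_le_sum fun a _ =>
        mul_le_mul_of_nonneg_right (mul_le_mul_of_nonneg_right (ih t) (hπ k t a)) (hP k t a s)
    · rw [truncVisit, if_neg hs]
      exact truncVisit_some_nonneg hP1 hP hπ T' (k + 1) s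

lemma MbarSets_succ_subset {S A : Type*} [Fintype S] [Fintype A] (P1 : S → ℝ)
    (P : ℕ → S → A → S → ℝ) (σ σ' : ℝ) (Γ : Finset (ℕ → S → A → ℝ)) (h j : ℕ) :
    MbarSets P1 P σ σ' Γ (h + 1) j ⊆ MbarSets P1 P σ σ' Γ h j := by
  cases h with
  | zero => exact Set.subset_univ _
  | succ h =>
    by_cases hj : j ≤ h
    · simp [MbarSets, hj, Nat.le_succ_of_le hj]
    · simp [MbarSets, hj]

/-- For every `h ∈ {1,…,H}`, every state `s`, and every policy `π`:
`d^{M̄_h(Γ),π}_h(s) ≤ d^{M̄_{h−1}(Γ),π}_h(s)`; consequently, for every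
`f : S ∪ {⊥} → [0,∞)` with `f ⊥ = 0`,
`E^{M̄_h(Γ),π}[f(s_h)] ≤ E^{M̄_{h−1}(Γ),π}[f(s_h)]`.
(Informal step `h` is internal index `h - 1`.) -/
theorem stmt6 {S A : Type*} [Fintype S] [Fintype A] [Nonempty S] [Nonempty A]
    (P1 : S → ℝ) (hP1 : (∀ s, 0 ≤ P1 s) ∧ ∑ s, P1 s = 1)
    (P : ℕ → S → A → S → ℝ)
    (hP : ∀ k s a, (∀ s', 0 ≤ P k s a s') ∧ ∑ s', P k s a s' = 1)
    (H : ℕ) (hH : 1 ≤ H) (σ σ' : ℝ) (hσ' : 0 < σ') (hσ : σ' ≤ σ)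
    (Γ : Finset (ℕ → S → A → ℝ)) (hΓ : ∀ π ∈ Γ, IsPolicy π)
    (h : ℕ) (hh1 : 1 ≤ h) (hh2 : h ≤ H)
    (π : ℕ → S → A → ℝ) (hπ : IsPolicy π) :
    (∀ s : S,
      truncVisit P1 P (MbarSets P1 P σ σ' Γ h) π (h - 1) (some s) ≤
        truncVisit P1 P (MbarSets P1 P σ σ' Γ (h - 1)) π (h - 1) (some s)) ∧
    (∀ f : Option S → ℝ, (∀ x, 0 ≤ f x) → f none = 0 →
      (∑ x, truncVisit P1 P (MbarSets P1 P σ σ' Γ h) π (h - 1) x * f x) ≤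
        ∑ x, truncVisit P1 P (MbarSets P1 P σ σ' Γ (h - 1)) π (h - 1) x * f x) := by
  obtain ⟨n, rfl⟩ : ∃ n, h = n + 1 := ⟨h - 1, by omega⟩
  rw [Nat.add_sub_cancel]
  have hmono : ∀ s : S, truncVisit P1 P (MbarSets P1 P σ σ' Γ (n + 1)) π n (some s) ≤
      truncVisit P1 P (MbarSets P1 P σ σ' Γ n) π n (some s) :=
    truncVisit_some_mono hP1.1 (fun k s a => (hP k s a).1) (fun k s => (hπ k s).1)
      (MbarSets_succ_subset P1 P σ σ' Γ n) n
  refine ⟨hmono, fun f hf hf0 => Finset.sum_le_sum fun x _ => ?_⟩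
  cases x with
  | none => simp [hf0]
  | some s => exact mul_le_mul_of_nonneg_right (hmono s) (hf (some s))
end

section
/- Let M be a finite-horizon latent MDP with state space S and let M̄(∅) and the sets S_h(∅) be defined as in the context with parameter σ. Then for every h ∈ {1,…,H} and every s ∈ S: if s ∈ S_h(∅) then sup_{π∈Π} d^{M̄(∅),π}_h(s) ≥ σ, and if s ∉ S_h(∅) then sup_{π∈Π} d^{M̄(∅),π}_h(s) = 0. -/
open scoped Classical

theorem prefixSets_of_le {S A : Type*} [Fintype S] [Fintype A] (P1 : S → ℝ)
    (P : ℕ → S → A → S → ℝ) (σ : ℝ) {j k : ℕ} (hjk : j ≤ k) :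
    prefixSets P1 P σ k j = SRchEmpty P1 P σ j := by
  induction k, hjk using Nat.le_induction with
  | base => rfl
  | succ k hk ih => simpa [prefixSets, hk] using ih

theorem prefixSets_of_lt {S A : Type*} [Fintype S] [Fintype A] (P1 : S → ℝ)
    (P : ℕ → S → A → S → ℝ) (σ : ℝ) {j k : ℕ} (hkj : k < j) :
    prefixSets P1 P σ k j = Set.univ := by
  cases k with
  | zero => simp [prefixSets, hkj.ne']
  | succ k => simp [prefixSets, hkj.ne', show ¬ j ≤ k by omega]

/-- Visitation probabilities of non-terminal states at step `k` depend only on the truncation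
sets up to step `k`. -/
theorem truncVisit_some_congr {S A : Type*} [Fintype S] [Fintype A] (P1 : S → ℝ)
    (P : ℕ → S → A → S → ℝ) {T T' : ℕ → Set S} (π : ℕ → S → A → ℝ) {k : ℕ}
    (hT : ∀ j ≤ k, T j = T' j) (s : S) :
    truncVisit P1 P T π k (some s) = truncVisit P1 P T' π k (some s) := by
  induction k generalizing s with
  | zero => simp [truncVisit, hT 0 le_rfl]
  | succ k ih =>
    simp only [truncVisit, hT (k + 1) le_rfl, ih fun j hj => hT j (hj.trans k.le_succ)]

theorem truncVisit_some_of_notMem {S A : Type*} [Fintype S] [Fintype A] (P1 : S → ℝ)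
    (P : ℕ → S → A → S → ℝ) {T : ℕ → Set S} (π : ℕ → S → A → ℝ) {k : ℕ} {s : S}
    (hs : s ∉ T k) : truncVisit P1 P T π k (some s) = 0 := by
  cases k <;> simp [truncVisit, hs]

/-- On `S_{k+1}(∅)`, truncating at the last step does not change visitation probabilities. -/
theorem truncVisit_SRchEmpty_succ {S A : Type*} [Fintype S] [Fintype A] (P1 : S → ℝ)
    (P : ℕ → S → A → S → ℝ) (σ : ℝ) (π : ℕ → S → A → ℝ) {k : ℕ} {s : S}
    (hs : s ∈ SRchEmpty P1 P σ (k + 1)) :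
    truncVisit P1 P (SRchEmpty P1 P σ) π (k + 1) (some s) =
      truncVisit P1 P (prefixSets P1 P σ k) π (k + 1) (some s) := by
  simp only [truncVisit, hs, prefixSets_of_lt P1 P σ k.lt_succ_self, Set.mem_univ, if_true,
    truncVisit_some_congr P1 P π fun j hj => (prefixSets_of_le P1 P σ hj).symm]

theorem exists_isPolicy (S A : Type*) [Fintype A] [Nonempty A] :
    ∃ π : ℕ → S → A → ℝ, IsPolicy π := by
  obtain ⟨a₀⟩ := ‹Nonempty A›
  refine ⟨fun _ _ a => if a = a₀ then 1 else 0, fun k s => ⟨fun a => ?_, by simp⟩⟩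
  dsimp only
  split_ifs <;> norm_num

theorem polSup_const {S A : Type*} [Fintype A] [Nonempty A] (c : ℝ) :
    (polSup fun _ : ℕ → S → A → ℝ => c) = c := by
  have hne : {π : ℕ → S → A → ℝ | IsPolicy π}.Nonempty := exists_isPolicy S A
  rw [polSup, hne.image_const, csSup_singleton]

/-- For every `h ∈ {1,…,H}` and every `s ∈ S`:
if `s ∈ S_h(∅)` then `sup_{π∈Π} d^{M̄(∅),π}_h(s) ≥ σ`, and if `s ∉ S_h(∅)` then
`sup_{π∈Π} d^{M̄(∅),π}_h(s) = 0`.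
(Informal step `h` is internal index `h - 1`.) -/
theorem stmt8 {S A : Type*} [Fintype S] [Fintype A] [Nonempty S] [Nonempty A]
    (P1 : S → ℝ) (hP1 : (∀ s, 0 ≤ P1 s) ∧ ∑ s, P1 s = 1)
    (P : ℕ → S → A → S → ℝ)
    (hP : ∀ k s a, (∀ s', 0 ≤ P k s a s') ∧ ∑ s', P k s a s' = 1)
    (H : ℕ) (hH : 1 ≤ H) (σ : ℝ) (hσ : 0 < σ)
    (h : ℕ) (hh1 : 1 ≤ h) (hh2 : h ≤ H) (s : S) :
    (s ∈ SRchEmpty P1 P σ (h - 1) →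
      σ ≤ polSup fun π =>
        truncVisit P1 P (SRchEmpty P1 P σ) π (h - 1) (some s)) ∧
    (s ∉ SRchEmpty P1 P σ (h - 1) →
      (polSup fun π =>
        truncVisit P1 P (SRchEmpty P1 P σ) π (h - 1) (some s)) = 0) := by
  refine ⟨fun hs => ?_, fun hs => ?_⟩
  · generalize h - 1 = k at hs ⊢
    cases k with
    | zero =>
      have hs' : σ ≤ P1 s := by simpa [SRchEmpty, prefixSets] using hs
      simpa only [truncVisit, hs, if_true, polSup_const] using hs'
    | succ k =>
      simp only [truncVisit_SRchEmpty_succ P1 P σ _ hs]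
      simpa [SRchEmpty, prefixSets] using hs
  · simp only [truncVisit_some_of_notMem P1 P _ hs, polSup_const]
end

section
/- Let M be a finite-horizon latent MDP with state space S, and fix a finite set Γ ⊂ Π and the truncation construction of the context. Then for every policy π ∈ Π and every h ∈ {1,…,H}: d^{M̄(Γ),π}_h(⊥) ≤ Σ_{k=1}^{h} Σ_{s ∈ S∖S_k(Γ)} d^{M,π}_k(s). -/
open scoped Classical

section TruncationBounds

variable {S A : Type*} [Fintype S] [Fintype A] {P1 : S → ℝ} {P : ℕ → S → A → S → ℝ}
  {π : ℕ → S → A → ℝ}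

theorem visit_nonneg (hP1 : ∀ s, 0 ≤ P1 s) (hP : ∀ k s a s', 0 ≤ P k s a s')
    (hπ : ∀ k s a, 0 ≤ π k s a) (k : ℕ) (s : S) : 0 ≤ visit P1 P π k s := by
  induction k generalizing s with
  | zero => exact hP1 s
  | succ k ih =>
    exact Finset.sum_nonneg fun t _ => Finset.sum_nonneg fun a _ =>
      mul_nonneg (mul_nonneg (ih t) (hπ k t a)) (hP k t a s)

/-- Truncation does not increase the visitation probability of a genuine state. -/
theorem truncVisit_some_le_visit (hP1 : ∀ s, 0 ≤ P1 s) (hP : ∀ k s a s', 0 ≤ P k s a s')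
    (hπ : ∀ k s a, 0 ≤ π k s a) (T : ℕ → Set S) (k : ℕ) (s : S) :
    truncVisit P1 P T π k (some s) ≤ visit P1 P π k s := by
  induction k generalizing s with
  | zero =>
    rw [truncVisit, visit]
    split_ifs
    exacts [le_rfl, hP1 s]
  | succ k ih =>
    rw [truncVisit]
    split_ifs
    · rw [visit]
      exact Finset.sum_le_sum fun t _ => Finset.sum_le_sum fun a _ =>
        mul_le_mul_of_nonneg_right (mul_le_mul_of_nonneg_right (ih t) (hπ k t a)) (hP k t a s)
    · exact visit_nonneg hP1 hP hπ (k + 1) s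

/-- The probability of having been absorbed is at most the total probability of visiting
a removed state, by a union bound over the steps. -/
theorem truncVisit_none_le (hP1 : ∀ s, 0 ≤ P1 s) (hP : ∀ k s a s', 0 ≤ P k s a s')
    (hπ : ∀ k s a, 0 ≤ π k s a) (T : ℕ → Set S) (n : ℕ) :
    truncVisit P1 P T π n none ≤
      ∑ k ∈ Finset.range (n + 1),
        ∑ s ∈ Finset.univ.filter (fun s => s ∉ T k), visit P1 P π k s := by
  induction n with
  | zero => simp [truncVisit, visit]
  | succ n ih =>
    rw [truncVisit, Finset.sum_range_succ]
    refine add_le_add ih ?_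
    simp only [visit]
    refine le_of_le_of_eq (Finset.sum_le_sum fun t _ => ?_) Finset.sum_comm
    refine le_of_le_of_eq ?_ Finset.sum_comm
    refine Finset.sum_le_sum fun a _ => ?_
    rw [← Finset.mul_sum]
    exact mul_le_mul_of_nonneg_right
      (mul_le_mul_of_nonneg_right (truncVisit_some_le_visit hP1 hP hπ T n t) (hπ n t a))
      (Finset.sum_nonneg fun s' _ => hP n t a s')

end TruncationBounds

/-- For every policy `π` and every `h ∈ {1,…,H}`:
`d^{M̄(Γ),π}_h(⊥) ≤ Σ_{k=1}^{h} Σ_{s ∉ S_k(Γ)} d^{M,π}_k(s)`.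
(Informal step `h` is internal index `h - 1`, so the informal sum over `k = 1,…,h`
becomes the internal sum over `k ∈ range h`.) -/
theorem stmt9 {S A : Type*} [Fintype S] [Fintype A] [Nonempty S] [Nonempty A]
    (P1 : S → ℝ) (hP1 : (∀ s, 0 ≤ P1 s) ∧ ∑ s, P1 s = 1)
    (P : ℕ → S → A → S → ℝ)
    (hP : ∀ k s a, (∀ s', 0 ≤ P k s a s') ∧ ∑ s', P k s a s' = 1)
    (H : ℕ) (hH : 1 ≤ H) (σ σ' : ℝ) (hσ' : 0 < σ') (hσ : σ' ≤ σ)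
    (Γ : Finset (ℕ → S → A → ℝ)) (hΓ : ∀ π ∈ Γ, IsPolicy π)
    (π : ℕ → S → A → ℝ) (hπ : IsPolicy π)
    (h : ℕ) (hh1 : 1 ≤ h) (hh2 : h ≤ H) :
    truncVisit P1 P (SRchGam P1 P σ σ' Γ) π (h - 1) none ≤
      ∑ k ∈ Finset.range h,
        ∑ s ∈ Finset.univ.filter (fun s => s ∉ SRchGam P1 P σ σ' Γ k),
          visit P1 P π k s := by
  obtain ⟨n, rfl⟩ := Nat.exists_eq_add_of_le' hh1
  exact truncVisit_none_le hP1.1 (fun k s a => (hP k s a).1) (fun k s => (hπ k s).1) _ n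
end

section
/- There is an absolute constant C > 0 such that for every integer n ≥ 2 the following holds. Let Φ_n := { x ↦ 1[⟨x,θ⟩ ≥ 0] : θ ∈ ℝⁿ } be the class of linear threshold functions ℝⁿ → {0,1}, and let F_n := { (x,a,x′) ↦ f(φ¹(x), φ²(x), φ³(x′), φ⁴(x′), a) : f : {0,1}⁵ → [0,1], φ¹, φ², φ³, φ⁴ ∈ Φ_n } be the induced class of functions ℝⁿ × {0,1} × ℝⁿ → [0,1]. Then the pseudo-dimension of F_n is at most C·n·log n; that is, there is no family of m > C·n·log n points (x_i, a_i, x′_i, ξ_i) ∈ ℝⁿ × {0,1} × ℝⁿ × ℝ such that for every b ∈ {0,1}^m there exists g ∈ F_n with 1[g(x_i,a_i,x′_i) > ξ_i] = b_i for all i ∈ {1,…,m}. -/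
open scoped Classical

/-- The linear threshold function (halfspace) `x ↦ 1[⟨x,θ⟩ ≥ 0]` with weights `θ`,
valued in `Bool` (`true` for `1`, `false` for `0`). -/
noncomputable def halfspace {n : ℕ} (θ : Fin n → ℝ) (x : Fin n → ℝ) : Bool :=
  if 0 ≤ ∑ j, x j * θ j then true else false

theorem halfspace_eq_true_iff {n : ℕ} (θ x : Fin n → ℝ) :
    halfspace θ x = true ↔ 0 ≤ ∑ j, x j * θ j := by
  simp [halfspace]

/-- The subsets of a finite family of points that are cut out by halfspaces. -/
noncomputable def halfspaceTraces {m n : ℕ} (x : Fin m → Fin n → ℝ) : Finset (Finset (Fin m)) :=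
  {s | ∃ θ : Fin n → ℝ, s = ({i | halfspace θ (x i) = true} : Finset (Fin m))}

theorem card_le_of_shatters_halfspaceTraces {m n : ℕ} (x : Fin m → Fin n → ℝ)
    {s : Finset (Fin m)} (hs : (halfspaceTraces x).Shatters s) : s.card ≤ n := by
  by_contra! hcard
  have hdep : ∃ c : Fin m → ℝ, ∑ i ∈ s, c i • x i = 0 ∧ ∃ i ∈ s, c i < 0 := by
    have hli : ¬ LinearIndepOn ℝ x (s : Set (Fin m)) := by
      intro h
      have h' := h.fintype_card_le_finrank
      simp at h'
      omega
    rw [linearIndepOn_finset_iff] at hli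
    push Not at hli
    obtain ⟨c, hc, i, hi, hne⟩ := hli
    rcases lt_or_gt_of_ne hne with h | h
    · exact ⟨c, hc, i, hi, h⟩
    · exact ⟨fun j => -c j, by simp [hc], i, hi, by simpa using h⟩
  obtain ⟨c, hc, i₀, hi₀, hneg⟩ := hdep
  obtain ⟨u, hu, hsu⟩ := hs (Finset.filter_subset (fun i => 0 ≤ c i) s)
  obtain ⟨θ, rfl⟩ := (Finset.mem_filter.1 hu).2
  have key : ∀ i ∈ s, (0 ≤ ∑ j, x i j * θ j ↔ 0 ≤ c i) := by
    intro i hi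
    have := Finset.ext_iff.1 hsu i
    simpa [hi, halfspace_eq_true_iff] using this
  have hsum : ∑ i ∈ s, c i * ∑ j, x i j * θ j = 0 := by
    calc ∑ i ∈ s, c i * ∑ j, x i j * θ j
        = ∑ j, (∑ i ∈ s, c i • x i) j * θ j := by
          simp only [Finset.mul_sum, Finset.sum_apply, Pi.smul_apply, smul_eq_mul, Finset.sum_mul]
          rw [Finset.sum_comm]
          simp only [mul_assoc]
      _ = 0 := by rw [hc]; simp
  have hpos : 0 < ∑ i ∈ s, c i * ∑ j, x i j * θ j := by
    refine Finset.sum_pos' (fun i hi => ?_) ⟨i₀, hi₀, ?_⟩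
    · by_cases h : 0 ≤ c i
      · exact mul_nonneg h ((key i hi).2 h)
      · exact mul_nonneg_of_nonpos_of_nonpos (not_le.1 h).le
          (not_le.1 (mt (key i hi).1 h)).le
    · exact mul_pos_of_neg_of_neg hneg (not_le.1 (mt (key i₀ hi₀).1 (not_le.2 hneg)))
  exact hpos.ne' hsum

theorem sum_choose_le_succ_pow (m n : ℕ) : ∑ k ∈ Finset.Iic n, m.choose k ≤ (m + 1) ^ n := by
  rw [← Nat.range_succ_eq_Iic]
  induction n with
  | zero => simp
  | succ n ih =>
    rw [Finset.sum_range_succ]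
    calc _ ≤ (m + 1) ^ n + m ^ n * m :=
          add_le_add ih ((Nat.choose_le_pow _ _).trans_eq (pow_succ _ _))
      _ ≤ (m + 1) ^ n + (m + 1) ^ n * m := by gcongr; omega
      _ = (m + 1) ^ (n + 1) := by ring

theorem card_halfspaceTraces_le {m n : ℕ} (x : Fin m → Fin n → ℝ) :
    (halfspaceTraces x).card ≤ (m + 1) ^ n := by
  have hvc : (halfspaceTraces x).vcDim ≤ n :=
    Finset.sup_le fun s hs =>
      card_le_of_shatters_halfspaceTraces x (Finset.mem_shatterer.1 hs)
  calc _ ≤ _ := Finset.card_le_card_shatterer _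
    _ ≤ _ := Finset.card_shatterer_le_sum_vcDim
    _ ≤ (m + 1) ^ (halfspaceTraces x).vcDim := by
      simpa using sum_choose_le_succ_pow m _
    _ ≤ _ := Nat.pow_le_pow_right (by omega) hvc

/-- The number of thresholds strictly below a given level. -/
noncomputable def thresholdRank {m : ℕ} (ξ : Fin m → ℝ) (t : ℝ) : Fin (m + 1) :=
  ⟨({i | ξ i < t} : Finset (Fin m)).card,
    Nat.lt_succ_of_le ((Finset.card_le_univ _).trans_eq (Fintype.card_fin m))⟩

theorem lt_iff_of_thresholdRank_eq {m : ℕ} {ξ : Fin m → ℝ} {s t : ℝ}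
    (h : thresholdRank ξ s = thresholdRank ξ t) (i : Fin m) : ξ i < s ↔ ξ i < t := by
  have hcard : ({i | ξ i < s} : Finset (Fin m)).card = ({i | ξ i < t} : Finset (Fin m)).card :=
    congrArg Fin.val h
  have hset : ({i | ξ i < s} : Finset (Fin m)) = ({i | ξ i < t} : Finset (Fin m)) := by
    rcases le_total s t with hst | hts
    · exact Finset.eq_of_subset_of_card_le
        (Finset.monotone_filter_right _ fun j _ hj => lt_of_lt_of_le hj hst) hcard.ge
    · exact (Finset.eq_of_subset_of_card_le
        (Finset.monotone_filter_right _ fun j _ hj => lt_of_lt_of_le hj hts) hcard.le).symm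
  simpa using Finset.ext_iff.1 hset i

theorem halfspace_eq_of_filter_eq {m n : ℕ} {x : Fin m → Fin n → ℝ} {θ η : Fin n → ℝ}
    (h : ({i | halfspace θ (x i) = true} : Finset (Fin m)) =
      ({i | halfspace η (x i) = true} : Finset (Fin m)))
    (i : Fin m) : halfspace θ (x i) = halfspace η (x i) := by
  rw [Bool.eq_iff_iff]
  simpa using Finset.ext_iff.1 h i

/-- A family of points shattered by the threshold indicators of the discriminator class satisfies
the growth-function inequality. -/
theorem two_pow_le_of_shattered {m n : ℕ} (x x' : Fin m → Fin n → ℝ) (a : Fin m → Bool)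
    (ξ : Fin m → ℝ)
    (h : ∀ b : Fin m → Bool, ∃ (f : Bool → Bool → Bool → Bool → Bool → ℝ)
      (θ₁ θ₂ θ₃ θ₄ : Fin n → ℝ), ∀ i : Fin m,
        (ξ i < f (halfspace θ₁ (x i)) (halfspace θ₂ (x i))
          (halfspace θ₃ (x' i)) (halfspace θ₄ (x' i)) (a i) ↔ b i = true)) :
    2 ^ m ≤ (m + 1) ^ (4 * n + 32) := by
  choose f θ₁ θ₂ θ₃ θ₄ hf using h
  let cut (y : Fin m → Fin n → ℝ) (θ : Fin n → ℝ) : halfspaceTraces y :=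
    ⟨({i | halfspace θ (y i) = true} : Finset (Fin m)),
      Finset.mem_filter.2 ⟨Finset.mem_univ _, θ, rfl⟩⟩
  let code (b : Fin m → Bool) : (halfspaceTraces x × halfspaceTraces x) ×
      (halfspaceTraces x' × halfspaceTraces x') ×
      (Bool × Bool × Bool × Bool × Bool → Fin (m + 1)) :=
    ((cut x (θ₁ b), cut x (θ₂ b)), (cut x' (θ₃ b), cut x' (θ₄ b)),
      fun v => thresholdRank ξ (f b v.1 v.2.1 v.2.2.1 v.2.2.2.1 v.2.2.2.2))
  have hinj : Function.Injective code := by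
    intro b b' hbb
    simp only [code, cut, Prod.mk.injEq] at hbb
    obtain ⟨⟨h₁, h₂⟩, ⟨h₃, h₄⟩, hr⟩ := hbb
    funext i
    rw [Bool.eq_iff_iff, ← hf b i, ← hf b' i, halfspace_eq_of_filter_eq (congrArg Subtype.val h₁),
      halfspace_eq_of_filter_eq (congrArg Subtype.val h₂), halfspace_eq_of_filter_eq (congrArg Subtype.val h₃),
      halfspace_eq_of_filter_eq (congrArg Subtype.val h₄)]
    exact lt_iff_of_thresholdRank_eq (congrFun hr (_, _, _, _, _)) i
  have hcard := Fintype.card_le_of_injective code hinj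
  simp only [Fintype.card_prod, Fintype.card_fun, Fintype.card_coe, Fintype.card_bool,
    Fintype.card_fin] at hcard
  calc 2 ^ m ≤ _ := hcard
    _ ≤ ((m + 1) ^ n * (m + 1) ^ n) * (((m + 1) ^ n * (m + 1) ^ n) *
          (m + 1) ^ (2 * (2 * (2 * (2 * 2))))) := by
        gcongr <;> exact card_halfspaceTraces_le _
    _ = (m + 1) ^ (4 * n + 32) := by ring

theorem le_of_two_pow_le_succ_pow {m n : ℕ} (hn : 2 ≤ n)
    (h : 2 ^ m ≤ (m + 1) ^ (4 * n + 32)) : (m : ℝ) ≤ 400 * n * Real.log n := by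
  have hn' : (2 : ℝ) ≤ n := by exact_mod_cast hn
  have hm : (0 : ℝ) ≤ m := m.cast_nonneg
  have hlog : (m : ℝ) * Real.log 2 ≤ (4 * n + 32) * Real.log (m + 1) := by
    have hk : ((4 * n + 32 : ℕ) : ℝ) = 4 * n + 32 := by push_cast; ring
    rw [← hk]
    generalize 4 * n + 32 = k at h
    have h' : (2 : ℝ) ^ m ≤ ((m : ℝ) + 1) ^ k := by exact_mod_cast h
    have := Real.log_le_log (pow_pos two_pos m) h'
    rwa [Real.log_pow, Real.log_pow] at this
  clear h
  have hlog0 : 0 ≤ Real.log (m + 1) := Real.log_nonneg (by linarith)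
  have htangent : Real.log (m + 1) ≤ (m + 1) / (80 * n) - 1 + (Real.log 80 + Real.log n) := by
    have h1 := Real.log_le_sub_one_of_pos (x := ((m : ℝ) + 1) / (80 * n)) (by positivity)
    rw [Real.log_div (by positivity) (by positivity),
      Real.log_mul (by norm_num) (by positivity)] at h1
    linarith
  have h80 : Real.log 80 ≤ 7 * Real.log n := by
    have h1 : Real.log 80 ≤ Real.log ((2 : ℝ) ^ 7) := Real.log_le_log (by norm_num) (by norm_num)
    rw [Real.log_pow] at h1
    have h2 := Real.log_le_log (by norm_num) hn'
    push_cast at h1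
    linarith
  have hmain : (m : ℝ) * Real.log 2 ≤ (m + 1) / 4 - 20 * n + 160 * (n * Real.log n) := by
    calc (m : ℝ) * Real.log 2 ≤ (20 * n) * Real.log (m + 1) :=
          hlog.trans (mul_le_mul_of_nonneg_right (by linarith) hlog0)
      _ ≤ (20 * n) * ((m + 1) / (80 * n) - 1 + 8 * Real.log n) := by
          gcongr
          linarith
      _ = _ := by field_simp; ring
  have hlog2 := mul_le_mul_of_nonneg_left Real.log_two_gt_d9.le hm
  linarith

/-- There is an absolute constant `C > 0` such that for every
`n ≥ 2`, the pseudo-dimension of the class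
`F_n = { (x,a,x′) ↦ f(φ¹ x, φ² x, φ³ x′, φ⁴ x′, a) : f : {0,1}⁵ → [0,1],
φ¹,…,φ⁴ halfspaces on ℝⁿ }` is at most `C·n·log n`: no family of `m > C·n·log n`
points `(xᵢ, aᵢ, x′ᵢ, ξᵢ)` realizes all `2^m` threshold sign patterns. -/
theorem stmt14 :
    ∃ C : ℝ, 0 < C ∧ ∀ n : ℕ, 2 ≤ n → ∀ m : ℕ,
      C * n * Real.log n < m →
      ¬ ∃ (x x' : Fin m → Fin n → ℝ) (a : Fin m → Bool) (ξ : Fin m → ℝ),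
          ∀ b : Fin m → Bool,
            ∃ (f : Bool → Bool → Bool → Bool → Bool → ℝ)
              (θ₁ θ₂ θ₃ θ₄ : Fin n → ℝ),
              (∀ v₁ v₂ v₃ v₄ v₅, f v₁ v₂ v₃ v₄ v₅ ∈ Set.Icc (0 : ℝ) 1) ∧
              ∀ i : Fin m,
                (ξ i <
                    f (halfspace θ₁ (x i)) (halfspace θ₂ (x i))
                      (halfspace θ₃ (x' i)) (halfspace θ₄ (x' i)) (a i) ↔
                  b i = true) := by
  refine ⟨400, by norm_num, fun n hn m hm => ?_⟩
  rintro ⟨x, x', a, ξ, h⟩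
  refine hm.not_ge (le_of_two_pow_le_succ_pow hn (two_pow_le_of_shattered x x' a ξ fun b => ?_))
  obtain ⟨f, θ₁, θ₂, θ₃, θ₄, -, hf⟩ := h b
  exact ⟨f, θ₁, θ₂, θ₃, θ₄, hf⟩
end
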